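/- There exist universal constants C ≥ c > 0 with the following property. Let L ≥ 1 and let u ∈ L²([0, L]³; ℝ³), extended L-periodically in each coordinate to ℝ³, with Fourier coefficients û(k) = L^{−3} ∫_{[0,L]³} u(x) e^{i k·x} dx ∈ ℂ³ for k ∈ (2π/L)ℤ³. Then c · Σ_k min(‖k‖², 1) ‖û(k)‖² ≤ Σ_{j=1}^{3} ∫_{1/2}^{3/2} L^{−3} ∫_{[0,L]³} ‖u(x + λ e_j) − u(x)‖² dx dλ ≤ C · Σ_k min(‖k‖², 1) ‖û(k)‖², where the sums run over k ∈ (2π/L)ℤ³, e_j are the coordinate unit vectors, and ‖·‖ denotes Euclidean norms. -/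

import Mathlib

open MeasureTheory ENNReal

noncomputable section

abbrev E3 := EuclideanSpace ℝ (Fin 3)

/-- The cube `[0,L]³`. -/
def box3 (L : ℝ) : Set E3 := {x : E3 | ∀ i, x i ∈ Set.Icc (0 : ℝ) L}

/-- The Fourier coefficient `û(k) = L⁻³ ∫_{[0,L]³} u(x) e^{i k·x} dx` of an `L`-periodic
field `u`, at the wave vector `k = (2π/L) m`, `m ∈ ℤ³`; its `i`-th component. -/
def fCoeff (L : ℝ) (u : E3 → E3) (m : Fin 3 → ℤ) (i : Fin 3) : ℂ :=
  ((L : ℂ) ^ 3)⁻¹ *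
    ∫ x in box3 L,
      Complex.exp (Complex.I * (∑ j : Fin 3, (2 * Real.pi / L) * (m j : ℝ) * x j)) *
        (u x i : ℂ)

/-- The spectral quantity `Σ_k min(‖k‖², 1) ‖û(k)‖²`, `k = (2π/L) m`, as a value
in `[0,∞]`. -/
def spectralSum (L : ℝ) (u : E3 → E3) : ENNReal :=
  ∑' m : Fin 3 → ℤ,
    ENNReal.ofReal
      (min ((2 * Real.pi / L) ^ 2 * ∑ j : Fin 3, (m j : ℝ) ^ 2) 1 *
        ∑ i : Fin 3, ‖fCoeff L u m i‖ ^ 2)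

/-- The averaged second order structure function at unit separation:
`Σ_j ∫_{1/2}^{3/2} L⁻³ ∫_{[0,L]³} ‖u(x + λ e_j) - u(x)‖² dx dλ`, as a value
in `[0,∞]`. -/
def structureSum (L : ℝ) (u : E3 → E3) : ENNReal :=
  ∑ j : Fin 3,
    ∫⁻ l in Set.Icc (1 / 2 : ℝ) (3 / 2),
      (∫⁻ x in box3 L,
          ENNReal.ofReal (‖u (x + l • EuclideanSpace.single j (1 : ℝ)) - u x‖ ^ 2)) /
        ENNReal.ofReal (L ^ 3)

open UnitAddTorus

local instance : MeasureSpace UnitAddCircle := ⟨AddCircle.haarAddCircle⟩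

local instance : Measure.IsAddHaarMeasure (volume : Measure UnitAddCircle) :=
  inferInstanceAs (Measure.IsAddHaarMeasure AddCircle.haarAddCircle)

local instance : IsProbabilityMeasure (volume : Measure UnitAddCircle) :=
  inferInstanceAs (IsProbabilityMeasure AddCircle.haarAddCircle)

/-- The rescaled projection `ℝ³ → ℝ³ / Lℤ³ ≃ (ℝ / ℤ)³`. -/
def torusProj (L : ℝ) (x : E3) : UnitAddTorus (Fin 3) := fun i => ((x i / L : ℝ) : UnitAddCircle)

lemma measurePreserving_coe_div {L : ℝ} (hL : 0 < L) :
    MeasurePreserving (fun x : ℝ => ((x / L : ℝ) : UnitAddCircle))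
      (volume.restrict (Set.Icc 0 L)) (ENNReal.ofReal L • volume) := by
  have h1 : MeasurePreserving (fun x : ℝ => L⁻¹ * x) volume (ENNReal.ofReal L • volume) :=
    ⟨by fun_prop, by
      rw [Real.map_volume_mul_left (inv_ne_zero hL.ne'), inv_inv, abs_of_pos hL]⟩
  have h2 := h1.restrict_preimage (measurableSet_Ioc (a := (0 : ℝ)) (b := 0 + 1))
  have h3 : (fun x : ℝ => L⁻¹ * x) ⁻¹' Set.Ioc (0 : ℝ) (0 + 1) = Set.Ioc 0 L := by
    ext x
    simp only [Set.mem_preimage, Set.mem_Ioc, zero_add, inv_mul_le_one₀ hL]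
    rw [mul_pos_iff_of_pos_left (inv_pos.2 hL)]
  rw [h3, Measure.restrict_smul, restrict_Ioc_eq_restrict_Icc] at h2
  have h4 := (AddCircle.measurePreserving_mk 1 0).smul_measure (ENNReal.ofReal L)
  rw [AddCircle.volume_eq_smul_haarAddCircle, ENNReal.ofReal_one, one_smul] at h4
  have h5 : (fun x : ℝ => ((x / L : ℝ) : UnitAddCircle)) =
      QuotientAddGroup.mk ∘ fun x : ℝ => L⁻¹ * x := by
    ext x
    simp only [Function.comp_apply, div_eq_inv_mul]
  rw [h5]
  exact h4.comp h2

lemma pi_smul_volume (a : ENNReal) (ha : a ≠ ⊤) :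
    Measure.pi (fun _ : Fin 3 => a • (volume : Measure UnitAddCircle)) = a ^ 3 • volume := by
  have : IsFiniteMeasure (a • (volume : Measure UnitAddCircle)) :=
    Measure.smul_finite _ ha
  refine Measure.pi_eq fun s _ => ?_
  simp [volume_pi, Measure.pi_pi, Fin.prod_univ_three, smul_eq_mul]
  ring

lemma measurePreserving_torusProj {L : ℝ} (hL : 0 < L) :
    MeasurePreserving (torusProj L) (volume.restrict (box3 L))
      (ENNReal.ofReal L ^ 3 • volume) := by
  have h1 := (PiLp.volume_preserving_ofLp (Fin 3)).restrict_preimage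
    (MeasurableSet.univ_pi fun _ : Fin 3 => measurableSet_Icc (a := (0 : ℝ)) (b := L))
  rw [volume_pi, Measure.restrict_pi_pi] at h1
  have : IsFiniteMeasure (ENNReal.ofReal L • (volume : Measure UnitAddCircle)) :=
    Measure.smul_finite _ ENNReal.ofReal_ne_top
  have h2 := measurePreserving_pi (fun _ : Fin 3 => (volume : Measure ℝ).restrict (Set.Icc 0 L))
    (fun _ => ENNReal.ofReal L • (volume : Measure UnitAddCircle))
    (fun _ => measurePreserving_coe_div hL)
  rw [pi_smul_volume _ ENNReal.ofReal_ne_top] at h2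
  have h3 : box3 L = WithLp.ofLp ⁻¹' Set.univ.pi fun _ : Fin 3 => Set.Icc (0 : ℝ) L := by
    ext x
    simp only [box3, Set.mem_ofPred_eq, Set.mem_preimage, Set.mem_pi, Set.mem_univ, true_imp_iff]
  rw [h3]
  exact h2.comp h1

lemma exists_torus_lift {L : ℝ} (hL : 0 < L) {u : E3 → E3} (hu : Measurable u)
    (hper : ∀ (x : E3) (i : Fin 3), u (x + EuclideanSpace.single i L) = u x) :
    ∃ w : UnitAddTorus (Fin 3) → E3, Measurable w ∧ ∀ x, w (torusProj L x) = u x := by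
  have hz (i : Fin 3) (n : ℤ) (x : E3) : u (x + n • EuclideanSpace.single i L) = u x := by
    have h : Function.Periodic u (EuclideanSpace.single i L) := fun x => hper x i
    exact h.zsmul n x
  refine ⟨fun y => u (WithLp.toLp 2 fun i => L * (AddCircle.measurableEquivIoc 1 0 (y i)).1),
    ?_, fun x => ?_⟩
  · refine hu.comp ((MeasurableEquiv.toLp 2 (Fin 3 → ℝ)).measurable.comp ?_)
    refine measurable_pi_lambda _ fun i => Measurable.const_mul ?_ L
    exact measurable_subtype_coe.comp
      ((AddCircle.measurableEquivIoc 1 0).measurable.comp (measurable_pi_apply i))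
  · have hn (i : Fin 3) : ∃ n : ℤ,
        L * (AddCircle.measurableEquivIoc 1 0 (torusProj L x i)).1 = x i + n * L := by
      have h : (((AddCircle.equivIoc (1 : ℝ) 0 (torusProj L x i)).1 : ℝ) : UnitAddCircle)
          = ((x i / L : ℝ) : UnitAddCircle) := AddCircle.coe_equivIoc
      rw [← sub_eq_zero, ← AddCircle.coe_sub, AddCircle.coe_eq_zero_iff] at h
      obtain ⟨n, hn⟩ := h
      refine ⟨n, ?_⟩
      change L * (AddCircle.equivIoc (1 : ℝ) 0 (torusProj L x i)).1 = _
      rw [eq_add_of_sub_eq hn.symm]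
      simp only [zsmul_eq_mul, mul_one]
      field_simp
      ring
    choose n hn using hn
    have hx : (WithLp.toLp 2 fun i => L * (AddCircle.measurableEquivIoc 1 0 (torusProj L x i)).1)
        = x + n 0 • EuclideanSpace.single 0 L + n 1 • EuclideanSpace.single 1 L
          + n 2 • EuclideanSpace.single 2 L := by
      ext i
      simp only [hn]
      fin_cases i <;> simp
    simp only [hx, hz]

lemma torusProj_add_smul_single (L l : ℝ) (x : E3) (j : Fin 3) :
    torusProj L (x + l • EuclideanSpace.single j (1 : ℝ)) =
      torusProj L x + Pi.single j ((l / L : ℝ) : UnitAddCircle) := by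
  ext i
  by_cases h : i = j
  · subst h
    simp [torusProj, add_div]
  · simp [torusProj, h]

lemma tsum_sq_mFourierCoeff {f : UnitAddTorus (Fin 3) → ℂ} (hf : MemLp f 2 volume) :
    ∑' m, ENNReal.ofReal (‖mFourierCoeff f m‖ ^ 2) = ∫⁻ y, ENNReal.ofReal (‖f y‖ ^ 2) := by
  have h := hasSum_sq_mFourierCoeff hf.toLp
  have hae := hf.coeFn_toLp
  have hc (m : Fin 3 → ℤ) : mFourierCoeff hf.toLp m = mFourierCoeff f m :=
    integral_congr_ae (by filter_upwards [hae] with y hy; rw [hy])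
  have hi : ∫ y, ‖(hf.toLp : UnitAddTorus (Fin 3) → ℂ) y‖ ^ 2 = ∫ y, ‖f y‖ ^ 2 :=
    integral_congr_ae (by filter_upwards [hae] with y hy; rw [hy])
  simp only [hc, hi] at h
  rw [← ENNReal.ofReal_tsum_of_nonneg (fun _ => sq_nonneg _) h.summable, h.tsum_eq,
    ofReal_integral_eq_lintegral_ofReal ((memLp_two_iff_integrable_sq_norm hf.1).1 hf)
      (Filter.Eventually.of_forall fun _ => sq_nonneg _)]

lemma mFourierCoeff_add_right_sub {f : UnitAddTorus (Fin 3) → ℂ} (hf : Integrable f volume)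
    (a : UnitAddTorus (Fin 3)) (m : Fin 3 → ℤ) :
    mFourierCoeff (fun y => f (y + a) - f y) m = (mFourier m a - 1) * mFourierCoeff f m := by
  have hi (g : UnitAddTorus (Fin 3) → ℂ) (hg : Integrable g volume) :
      Integrable (fun y => mFourier (-m) y • g y) volume :=
    hg.bdd_mul (c := 1) (mFourier (-m)).continuous.aestronglyMeasurable
      (Filter.Eventually.of_forall fun y => by
        simpa [mFourier_norm] using (mFourier (-m)).norm_coe_le_norm y)
  have hs : Integrable (fun y => f (y + a)) volume := hf.comp_add_right a
  have hprod (y : UnitAddTorus (Fin 3)) :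
      mFourier (-m) y = mFourier m a * mFourier (-m) (y + a) := by
    simp only [mFourier, ContinuousMap.coe_mk, ← Finset.prod_mul_distrib]
    refine Finset.prod_congr rfl fun i _ => ?_
    simp only [fourier_apply, Pi.neg_apply, Pi.add_apply, ← Circle.coe_mul,
      ← AddCircle.toCircle_add]
    congr 2
    simp [smul_add]
  have htrans : ∫ y, mFourier (-m) y • f (y + a) = mFourier m a * mFourierCoeff f m := by
    rw [mFourierCoeff, ← integral_const_mul,
      ← integral_add_right_eq_self (fun y => mFourier m a * mFourier (-m) y • f y) a]
    refine integral_congr_ae (Filter.Eventually.of_forall fun y => ?_)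
    simp only [hprod y, smul_eq_mul, mul_assoc]
  simp only [mFourierCoeff, smul_sub]
  rw [integral_sub (hi _ hs) (hi _ hf), htrans, mFourierCoeff, sub_mul, one_mul]

lemma norm_mFourier_single_sub_one_sq (m : Fin 3 → ℤ) (j : Fin 3) (t : ℝ) :
    ‖mFourier m (Pi.single j (t : UnitAddCircle)) - 1‖ ^ 2 =
      2 - 2 * Real.cos (2 * Real.pi * m j * t) := by
  have h : mFourier m (Pi.single j (t : UnitAddCircle)) =
      Complex.exp (Complex.I * ((2 * Real.pi * m j * t : ℝ) : ℂ)) := by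
    rw [mFourier, ContinuousMap.coe_mk, Finset.prod_eq_single j]
    · rw [Pi.single_eq_same, fourier_coe_apply]
      push_cast
      congr 1
      ring
    · intro i _ hi
      rw [Pi.single_eq_of_ne hi, fourier_eval_zero]
    · simp
  rw [h, Complex.norm_exp_I_mul_ofReal_sub_one, Real.norm_eq_abs, sq_abs, mul_pow,
    Real.sin_sq_eq_half_sub]
  ring_nf

lemma lintegral_sq_increment {w : UnitAddTorus (Fin 3) → E3}
    (hw : MemLp w 2 volume) (j : Fin 3) (t : ℝ) :
    ∫⁻ y, ENNReal.ofReal (‖w (y + Pi.single j (t : UnitAddCircle)) - w y‖ ^ 2) =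
      ∑' m : Fin 3 → ℤ, ENNReal.ofReal (2 - 2 * Real.cos (2 * Real.pi * m j * t)) *
        ENNReal.ofReal (∑ i, ‖mFourierCoeff (fun y => (w y i : ℂ)) m‖ ^ 2) := by
  have hwi (i : Fin 3) : MemLp (fun y => (w y i : ℂ)) 2 volume :=
    ((EuclideanSpace.proj (𝕜 := ℝ) i).comp_memLp' hw).ofReal
  set a : UnitAddTorus (Fin 3) := Pi.single j (t : UnitAddCircle) with ha
  have hsi (i : Fin 3) : MemLp (fun y => (w (y + a) i : ℂ)) 2 volume :=
    (hwi i).comp_measurePreserving (measurePreserving_add_right volume a)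
  have hd (i : Fin 3) : MemLp (fun y => (w (y + a) i : ℂ) - (w y i : ℂ)) 2 volume :=
    (hsi i).sub (hwi i)
  have h1 (y : UnitAddTorus (Fin 3)) : ENNReal.ofReal (‖w (y + a) - w y‖ ^ 2) =
      ∑ i, ENNReal.ofReal (‖(w (y + a) i : ℂ) - (w y i : ℂ)‖ ^ 2) := by
    rw [EuclideanSpace.norm_sq_eq, ENNReal.ofReal_sum_of_nonneg fun _ _ => sq_nonneg _]
    refine Finset.sum_congr rfl fun i _ => ?_
    rw [← Complex.ofReal_sub, Complex.norm_real, PiLp.sub_apply]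
  simp only [h1]
  rw [lintegral_finsetSum' _ fun i _ =>
    ((hd i).1.norm.aemeasurable.pow_const 2).ennreal_ofReal]
  simp only [← tsum_sq_mFourierCoeff (hd _)]
  rw [← Summable.tsum_finsetSum fun _ _ => ENNReal.summable]
  refine tsum_congr fun m => ?_
  have hnn : 0 ≤ 2 - 2 * Real.cos (2 * Real.pi * m j * t) := by
    linarith [Real.cos_le_one (2 * Real.pi * m j * t)]
  rw [← ENNReal.ofReal_mul hnn, Finset.mul_sum,
    ENNReal.ofReal_sum_of_nonneg fun _ _ => by positivity]
  refine Finset.sum_congr rfl fun i _ => ?_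
  rw [mFourierCoeff_add_right_sub ((hwi i).integrable one_le_two) a m, norm_mul, mul_pow, ha,
    norm_mFourier_single_sub_one_sq]

lemma fCoeff_eq_mFourierCoeff {L : ℝ} (hL : 0 < L) {u : E3 → E3}
    {w : UnitAddTorus (Fin 3) → E3} (hw : Measurable w) (huw : ∀ x, w (torusProj L x) = u x)
    (m : Fin 3 → ℤ) (i : Fin 3) :
    fCoeff L u m i = mFourierCoeff (fun y => (w y i : ℂ)) (-m) := by
  have hmp := measurePreserving_torusProj hL
  have hmeas : Measurable fun y : UnitAddTorus (Fin 3) => mFourier m y * (w y i : ℂ) :=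
    (mFourier m).continuous.measurable.mul
      (Complex.measurable_ofReal.comp
        ((EuclideanSpace.proj (𝕜 := ℝ) i).continuous.measurable.comp hw))
  have hpt (x : E3) : Complex.exp (Complex.I *
      (∑ j : Fin 3, (2 * Real.pi / L) * (m j : ℝ) * x j)) * (u x i : ℂ) =
      mFourier m (torusProj L x) * (w (torusProj L x) i : ℂ) := by
    rw [huw]
    congr 1
    simp only [mFourier, ContinuousMap.coe_mk, torusProj, fourier_coe_apply, ← Complex.exp_sum]
    congr 1
    push_cast
    rw [Finset.mul_sum]
    refine Finset.sum_congr rfl fun j _ => ?_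
    field_simp
  have hL3 : (ENNReal.ofReal L ^ 3).toReal = L ^ 3 := by
    rw [ENNReal.toReal_pow, ENNReal.toReal_ofReal hL.le]
  rw [fCoeff]
  simp only [hpt]
  rw [← integral_map hmp.measurable.aemeasurable (f := fun y => mFourier m y * (w y i : ℂ))
    hmeas.aestronglyMeasurable, hmp.map_eq, integral_smul_measure, hL3, mFourierCoeff, neg_neg]
  have : (L : ℂ) ≠ 0 := by exact_mod_cast hL.ne'
  simp only [Complex.real_smul, smul_eq_mul]
  push_cast
  field_simp

/-- The average over `λ ∈ [1/2, 3/2]` of `|exp(iκλ) - 1|²`. -/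
def incrementWeight (κ : ℝ) : ENNReal :=
  ∫⁻ l in Set.Icc (1 / 2 : ℝ) (3 / 2), ENNReal.ofReal (2 - 2 * Real.cos (κ * l))

lemma volume_Icc_half : volume (Set.Icc (1 / 2 : ℝ) (3 / 2)) = 1 := by
  rw [Real.volume_Icc]
  norm_num

lemma incrementWeight_neg (κ : ℝ) : incrementWeight (-κ) = incrementWeight κ := by
  simp [incrementWeight]

lemma incrementWeight_le (κ : ℝ) :
    incrementWeight κ ≤ ENNReal.ofReal (4 * min (κ ^ 2) 1) := by
  have h : incrementWeight κ ≤
      ∫⁻ _ in Set.Icc (1 / 2 : ℝ) (3 / 2), ENNReal.ofReal (4 * min (κ ^ 2) 1) := by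
    refine setLIntegral_mono measurable_const fun l hl => ENNReal.ofReal_le_ofReal ?_
    rcases min_choice (κ ^ 2) 1 with h | h <;> rw [h]
    · have h1 := Real.one_sub_sq_div_two_le_cos (x := κ * l)
      have h2 : l ^ 2 ≤ 4 := by nlinarith [hl.1, hl.2]
      nlinarith [mul_le_mul_of_nonneg_left h2 (sq_nonneg κ)]
    · linarith [Real.neg_one_le_cos (κ * l)]
  rwa [setLIntegral_const, volume_Icc_half, mul_one] at h

lemma le_incrementWeight_of_abs_le {κ : ℝ} (hκ : |κ| ≤ 41 / 20) :
    ENNReal.ofReal (1 / 25 * min (κ ^ 2) 1) ≤ incrementWeight κ := by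
  have h : ∫⁻ _ in Set.Icc (1 / 2 : ℝ) (3 / 2), ENNReal.ofReal (1 / 25 * min (κ ^ 2) 1) ≤
      incrementWeight κ := by
    refine setLIntegral_mono (by fun_prop) fun l hl => ENNReal.ofReal_le_ofReal ?_
    have hl0 : 0 ≤ l := by linarith [hl.1]
    have habs : |κ * l| ≤ Real.pi := by
      rw [abs_mul, abs_of_nonneg hl0]
      nlinarith [Real.pi_gt_d2, hl.2, abs_nonneg κ]
    have h1 := Real.cos_le_one_sub_mul_cos_sq habs
    have h2 : 1 / 8 ≤ 2 / Real.pi ^ 2 := by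
      rw [div_le_div_iff₀ (by norm_num) (by positivity)]
      nlinarith [Real.pi_lt_d2, Real.pi_pos]
    have h3 : 1 / 4 ≤ l ^ 2 := by nlinarith [hl.1]
    have h4 : κ ^ 2 * (1 / 4) ≤ (κ * l) ^ 2 := by
      rw [mul_pow]
      exact mul_le_mul_of_nonneg_left h3 (sq_nonneg κ)
    have h5 := mul_le_mul h2 h4 (by positivity) (by positivity)
    linarith [min_le_left (κ ^ 2) 1, sq_nonneg κ]
  rwa [setLIntegral_const, volume_Icc_half, mul_one] at h

lemma le_incrementWeight_of_le {κ : ℝ} (hκ : 41 / 20 ≤ κ) :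
    ENNReal.ofReal (1 / 25 * min (κ ^ 2) 1) ≤ incrementWeight κ := by
  have hκ0 : 0 < κ := by linarith
  have hint : ∫ l in Set.Icc (1 / 2 : ℝ) (3 / 2), (2 - 2 * Real.cos (κ * l)) =
      2 - 4 * (Real.cos κ * Real.sin (κ / 2)) / κ := by
    rw [integral_Icc_eq_integral_Ioc, ← intervalIntegral.integral_of_le (by norm_num),
      intervalIntegral.integral_sub (by simp) (Continuous.intervalIntegrable (by fun_prop) _ _),
      intervalIntegral.integral_const_mul, intervalIntegral.integral_comp_mul_left _ hκ0.ne',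
      integral_cos]
    have h1 : κ * (3 / 2) = κ + κ / 2 := by ring
    have h2 : κ * (1 / 2) = κ - κ / 2 := by ring
    rw [h1, h2, Real.sin_add, Real.sin_sub]
    simp only [intervalIntegral.integral_const, smul_eq_mul]
    ring
  rw [incrementWeight, ← ofReal_integral_eq_lintegral_ofReal
    (ContinuousOn.integrableOn_compact isCompact_Icc (by fun_prop))
    (Filter.Eventually.of_forall fun l => by
      simp only [Pi.zero_apply]
      linarith [Real.cos_le_one (κ * l)]), hint]
  refine ENNReal.ofReal_le_ofReal ?_
  have h1 : Real.cos κ * Real.sin (κ / 2) ≤ 1 := by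
    refine (le_abs_self _).trans ?_
    rw [abs_mul]
    exact mul_le_one₀ (Real.abs_cos_le_one κ) (abs_nonneg _) (Real.abs_sin_le_one _)
  have h2 : 4 * (Real.cos κ * Real.sin (κ / 2)) / κ ≤ 49 / 25 := by
    rw [div_le_iff₀ hκ0]
    linarith
  linarith [min_le_right (κ ^ 2) 1]

lemma le_incrementWeight (κ : ℝ) :
    ENNReal.ofReal (1 / 25 * min (κ ^ 2) 1) ≤ incrementWeight κ := by
  rcases le_total |κ| (41 / 20) with h | h
  · exact le_incrementWeight_of_abs_le h
  · rcases le_abs.1 h with h | h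
    · exact le_incrementWeight_of_le h
    · rw [← incrementWeight_neg, ← neg_sq]
      exact le_incrementWeight_of_le h

lemma sum_incrementWeight_le {ι : Type*} [Fintype ι] (κ : ι → ℝ) :
    ∑ j, incrementWeight (κ j) ≤
      ENNReal.ofReal (4 * Fintype.card ι * min (∑ j, κ j ^ 2) 1) := by
  have h (j : ι) : min (κ j ^ 2) 1 ≤ min (∑ j, κ j ^ 2) 1 :=
    min_le_min_right 1
      (Finset.single_le_sum (f := fun j => κ j ^ 2) (fun _ _ => sq_nonneg _) (Finset.mem_univ j))
  calc ∑ j, incrementWeight (κ j)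
      ≤ ∑ _j : ι, ENNReal.ofReal (4 * min (∑ j, κ j ^ 2) 1) :=
        Finset.sum_le_sum fun j _ => (incrementWeight_le _).trans
          (ENNReal.ofReal_le_ofReal (by linarith [h j]))
    _ = ENNReal.ofReal (4 * Fintype.card ι * min (∑ j, κ j ^ 2) 1) := by
        rw [Finset.sum_const, ← ENNReal.ofReal_nsmul, Finset.card_univ, nsmul_eq_mul]
        ring_nf

lemma min_sum_one_le_sum_min {ι : Type*} (s : Finset ι) {f : ι → ℝ} (hf : ∀ j, 0 ≤ f j) :
    min (∑ j ∈ s, f j) 1 ≤ ∑ j ∈ s, min (f j) 1 := by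
  by_cases h : ∃ j ∈ s, 1 ≤ f j
  · obtain ⟨j, hj, h1⟩ := h
    calc min (∑ j ∈ s, f j) 1 ≤ min (f j) 1 := by simp [h1]
      _ ≤ ∑ j ∈ s, min (f j) 1 :=
        Finset.single_le_sum (f := fun j => min (f j) 1)
          (fun i _ => le_min (hf i) zero_le_one) hj
  · push Not at h
    rw [Finset.sum_congr rfl fun j hj => min_eq_left (h j hj).le]
    exact min_le_left _ _

lemma le_sum_incrementWeight {ι : Type*} [Fintype ι] (κ : ι → ℝ) :
    ENNReal.ofReal (1 / 25 * min (∑ j, κ j ^ 2) 1) ≤ ∑ j, incrementWeight (κ j) := by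
  calc ENNReal.ofReal (1 / 25 * min (∑ j, κ j ^ 2) 1)
      ≤ ENNReal.ofReal (∑ j, 1 / 25 * min (κ j ^ 2) 1) := by
        rw [← Finset.mul_sum]
        exact ENNReal.ofReal_le_ofReal (mul_le_mul_of_nonneg_left
          (min_sum_one_le_sum_min _ fun _ => sq_nonneg _) (by norm_num))
    _ = ∑ j, ENNReal.ofReal (1 / 25 * min (κ j ^ 2) 1) :=
        ENNReal.ofReal_sum_of_nonneg fun _ _ => by positivity
    _ ≤ ∑ j, incrementWeight (κ j) := Finset.sum_le_sum fun j _ => le_incrementWeight _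

lemma structureSum_eq_tsum {L : ℝ} (hL : 0 < L) {u : E3 → E3} (hu : Measurable u)
    (hper : ∀ (x : E3) (i : Fin 3), u (x + EuclideanSpace.single i L) = u x)
    (hint : (∫⁻ x in box3 L, ENNReal.ofReal (‖u x‖ ^ 2)) < ⊤) :
    structureSum L u = ∑' m : Fin 3 → ℤ, (∑ j, incrementWeight (2 * Real.pi / L * m j)) *
      ENNReal.ofReal (∑ i, ‖fCoeff L u m i‖ ^ 2) := by
  obtain ⟨w, hw, huw⟩ := exists_torus_lift hL hu hper
  have hmp := measurePreserving_torusProj hL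
  have hL3 : ENNReal.ofReal L ^ 3 ≠ 0 := by simp [hL]
  have hL3' : ENNReal.ofReal L ^ 3 ≠ ⊤ := by simp
  have hchange (g : UnitAddTorus (Fin 3) → ENNReal) (hg : Measurable g) :
      ∫⁻ x in box3 L, g (torusProj L x) = ENNReal.ofReal L ^ 3 * ∫⁻ y, g y := by
    rw [hmp.lintegral_comp hg, lintegral_smul_measure, smul_eq_mul]
  have hmem : MemLp w 2 volume := by
    rw [memLp_two_iff_integrable_sq_norm hw.aestronglyMeasurable]
    refine ⟨(hw.norm.pow_const 2).aestronglyMeasurable, ?_⟩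
    rw [hasFiniteIntegral_iff_ofReal (Filter.Eventually.of_forall fun _ => sq_nonneg _)]
    simp only [← huw] at hint
    rw [hchange (fun y => ENNReal.ofReal (‖w y‖ ^ 2)) (by fun_prop)] at hint
    exact lt_top_of_mul_ne_top_right hint.ne hL3
  have hinner (j : Fin 3) (l : ℝ) :
      (∫⁻ x in box3 L,
          ENNReal.ofReal (‖u (x + l • EuclideanSpace.single j (1 : ℝ)) - u x‖ ^ 2)) /
        ENNReal.ofReal (L ^ 3) =
      ∑' m : Fin 3 → ℤ, ENNReal.ofReal (2 - 2 * Real.cos (2 * Real.pi / L * m j * l)) *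
        ENNReal.ofReal (∑ i, ‖mFourierCoeff (fun y => (w y i : ℂ)) m‖ ^ 2) := by
    simp only [← huw, torusProj_add_smul_single]
    rw [hchange (fun y => ENNReal.ofReal
        (‖w (y + (Pi.single j ((l / L : ℝ) : UnitAddCircle) : Fin 3 → UnitAddCircle)) - w y‖ ^ 2)) (by fun_prop), ENNReal.ofReal_pow hL.le,
      mul_comm, ENNReal.mul_div_cancel_right hL3 hL3', lintegral_sq_increment hmem]
    refine tsum_congr fun m => ?_
    congr 4
    ring_nf
  rw [structureSum]
  simp only [hinner]
  rw [← (Equiv.neg (Fin 3 → ℤ)).tsum_eq]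
  simp only [Equiv.neg_apply, Pi.neg_apply, Int.cast_neg, mul_neg, incrementWeight_neg,
    fCoeff_eq_mFourierCoeff hL hw huw, neg_neg, Finset.sum_mul]
  rw [Summable.tsum_finsetSum fun _ _ => ENNReal.summable]
  refine Finset.sum_congr rfl fun j _ => ?_
  rw [lintegral_tsum fun m => by fun_prop]
  refine tsum_congr fun m => ?_
  rw [lintegral_mul_const _ (by fun_prop), incrementWeight]

/-- **Statement 12.** There are universal constants `C ≥ c > 0` such that for every
`L ≥ 1` and every `L`-periodic square-integrable field `u : ℝ³ → ℝ³`,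
`c Σ_k min(‖k‖²,1)‖û(k)‖² ≤ Σ_j ∫_{1/2}^{3/2} L⁻³∫_{[0,L]³} ‖u(x+λe_j)-u(x)‖² dx dλ
  ≤ C Σ_k min(‖k‖²,1)‖û(k)‖²`. -/
theorem stmt12 :
    ∃ c C : ℝ, 0 < c ∧ c ≤ C ∧
      ∀ L : ℝ, 1 ≤ L → ∀ u : E3 → E3, Measurable u →
        (∀ (x : E3) (i : Fin 3), u (x + EuclideanSpace.single i L) = u x) →
        (∫⁻ x in box3 L, ENNReal.ofReal (‖u x‖ ^ 2)) < ⊤ →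
        ENNReal.ofReal c * spectralSum L u ≤ structureSum L u ∧
          structureSum L u ≤ ENNReal.ofReal C * spectralSum L u := by
  refine ⟨1 / 25, 12, by norm_num, by norm_num, fun L hL u hu hper hint => ?_⟩
  have hterm (a : ℝ) (ha : 0 ≤ a) (m : Fin 3 → ℤ) :
      ENNReal.ofReal a * ENNReal.ofReal
        (min ((2 * Real.pi / L) ^ 2 * ∑ j : Fin 3, (m j : ℝ) ^ 2) 1 *
          ∑ i : Fin 3, ‖fCoeff L u m i‖ ^ 2) =
      ENNReal.ofReal (a * min (∑ j : Fin 3, (2 * Real.pi / L * m j) ^ 2) 1) *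
        ENNReal.ofReal (∑ i : Fin 3, ‖fCoeff L u m i‖ ^ 2) := by
    simp only [mul_pow, ← Finset.mul_sum]
    rw [← ENNReal.ofReal_mul ha, ← ENNReal.ofReal_mul (by positivity), mul_assoc]
  rw [structureSum_eq_tsum (by linarith) hu hper hint, spectralSum, ← ENNReal.tsum_mul_left,
    ← ENNReal.tsum_mul_left]
  refine ⟨ENNReal.tsum_le_tsum fun m => ?_, ENNReal.tsum_le_tsum fun m => ?_⟩
  · rw [hterm _ (by norm_num)]
    gcongr
    exact le_sum_incrementWeight _
  · rw [hterm _ (by norm_num)]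
    gcongr
    refine (sum_incrementWeight_le _).trans_eq ?_
    norm_num
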